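/- For every integer e ≥ 1, c_e^{2e−1} = e·(2e−1)!!. That is, the number of (2e−2)-dimensional partitions λ ⊆ ℕ^{2e−1} of size 3e with embedding dimension h_λ(1) = 2e−1 and socle contained in λ_{≥2} equals e·(2e−1)!!. -/

import Mathlib

open Finset

attribute [local instance] Classical.propDecidable

noncomputable section

/-- A finite downward-closed subset of `ℕ^n` (an `(n-1)`-dimensional partition). -/
def IsPartitionFn {n : ℕ} (lam : Finset (Fin n → ℕ)) : Prop :=
  ∀ a ∈ lam, ∀ y : Fin n → ℕ, y ≤ a → y ∈ lam

/-- Degree of a lattice point. -/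
def degFn {n : ℕ} (y : Fin n → ℕ) : ℕ := ∑ i, y i

/-- Hilbert–Samuel function. -/
def hsFn {n : ℕ} (lam : Finset (Fin n → ℕ)) (k : ℕ) : ℕ :=
  (lam.filter fun a => degFn a = k).card

/-- Socle: maximal elements. -/
def socleFn {n : ℕ} (lam : Finset (Fin n → ℕ)) : Finset (Fin n → ℕ) :=
  lam.filter fun a => ∀ b ∈ lam, ¬ a < b

/-- Number of `(n-1)`-dimensional partitions of size `d`. -/
def pNum (d n : ℕ) : ℕ :=
  Set.ncard {lam : Finset (Fin n → ℕ) | IsPartitionFn lam ∧ lam.card = d}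

/-- Number of `(k-1)`-dimensional partitions of size `d` and embedding dimension `k`. -/
def yNum (d k : ℕ) : ℕ :=
  Set.ncard {lam : Finset (Fin k → ℕ) | IsPartitionFn lam ∧ lam.card = d ∧ hsFn lam 1 = k}

/-- Number of `(k-1)`-dimensional partitions of size `1+k+e`, embedding dimension `k`,
and socle in degree `≥ 2`. -/
def cNum (e k : ℕ) : ℕ :=
  Set.ncard {lam : Finset (Fin k → ℕ) | IsPartitionFn lam ∧ lam.card = 1 + k + e ∧
    hsFn lam 1 = k ∧ ∀ a ∈ socleFn lam, 2 ≤ degFn a}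

end

section Aux

variable {k : ℕ}

lemma deg_add (x y : Fin k → ℕ) : degFn (x + y) = degFn x + degFn y := by
  simp [degFn, Finset.sum_add_distrib]

lemma deg_zero_iff (y : Fin k → ℕ) : degFn y = 0 ↔ y = 0 := by
  simp [degFn, funext_iff]

lemma deg_single (i : Fin k) : degFn (Pi.single i 1 : Fin k → ℕ) = 1 := by
  simp [degFn]

lemma deg_mono {x y : Fin k → ℕ} (h : x ≤ y) : degFn x ≤ degFn y :=
  Finset.sum_le_sum fun i _ => h i

lemma eq_of_le_of_deg {x y : Fin k → ℕ} (h : x ≤ y) (hd : degFn y ≤ degFn x) : x = y := by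
  obtain ⟨z, rfl⟩ := exists_add_of_le h
  rw [deg_add] at hd
  have : z = 0 := (deg_zero_iff z).1 (by omega)
  simp [this]

lemma single_le {y : Fin k → ℕ} {i : Fin k} (h : 0 < y i) : (Pi.single i 1 : Fin k → ℕ) ≤ y := by
  intro j
  by_cases hj : j = i
  · subst hj; simpa using Nat.succ_le_of_lt h
  · simp [hj]

lemma exists_pos_of_ne {y : Fin k → ℕ} (h : y ≠ 0) : ∃ i, 0 < y i := by
  by_contra hc
  push Not at hc
  exact h (funext fun i => by simpa using hc i)

lemma split_single {y : Fin k → ℕ} {i : Fin k} (h : 0 < y i) :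
    ∃ z : Fin k → ℕ, y = Pi.single i 1 + z := exists_add_of_le (single_le h)

lemma deg_one {y : Fin k → ℕ} (h : degFn y = 1) : ∃ i, y = Pi.single i 1 := by
  obtain ⟨i, hi⟩ := exists_pos_of_ne (y := y) (by rintro rfl; simp [degFn] at h)
  obtain ⟨z, rfl⟩ := split_single hi
  rw [deg_add, deg_single] at h
  have : z = 0 := (deg_zero_iff z).1 (by omega)
  exact ⟨i, by simp [this]⟩

lemma deg_two {y : Fin k → ℕ} (h : degFn y = 2) {i : Fin k} (hi : 0 < y i) :
    ∃ j, y = Pi.single i 1 + Pi.single j 1 := by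
  obtain ⟨z, rfl⟩ := split_single hi
  rw [deg_add, deg_single] at h
  obtain ⟨j, rfl⟩ := deg_one (y := z) (by omega)
  exact ⟨j, rfl⟩

lemma deg_sum (S : Finset (Fin k → ℕ)) (h : ∀ s ∈ S, degFn s = 2) :
    degFn (∑ s ∈ S, s) = 2 * S.card := by
  have : degFn (∑ s ∈ S, s) = ∑ s ∈ S, degFn s := by
    simp only [degFn, Finset.sum_apply]
    exact Finset.sum_comm
  rw [this, Finset.sum_congr rfl h]; simp [mul_comm]

/-- sets of degree-two vectors with given sum -/
noncomputable def PF (d : Fin k → ℕ) : Finset (Finset (Fin k → ℕ)) :=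
  ((Finset.Iic d).powerset).filter fun S => (∀ s ∈ S, degFn s = 2) ∧ ∑ s ∈ S, s = d

lemma mem_PF {d : Fin k → ℕ} {S : Finset (Fin k → ℕ)} :
    S ∈ PF d ↔ (∀ s ∈ S, degFn s = 2) ∧ ∑ s ∈ S, s = d := by
  unfold PF
  simp only [Finset.mem_filter, Finset.mem_powerset, and_iff_right_iff_imp]
  rintro ⟨-, rfl⟩ s hs
  rw [Finset.mem_Iic]
  exact Finset.single_le_sum (f := fun s : Fin k → ℕ => s) (fun i _ => zero_le) hs

noncomputable def starAt (v : Fin k) (S : Finset (Fin k → ℕ)) : Finset (Fin k → ℕ) :=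
  S.filter fun s => 0 < s v

lemma card_fiber (v : Fin k) (T : Finset (Fin k → ℕ)) (d d' : Fin k → ℕ)
    (hT : ∀ t ∈ T, degFn t = 2) (hv : ∀ t ∈ T, 0 < t v) (hd : d = ∑ t ∈ T, t + d')
    (hd' : d' v = 0) :
    ((PF d).filter fun S => starAt v S = T).card = (PF d').card := by
  subst hd
  have key : ∀ R ∈ PF d', ∀ r ∈ R, r v = 0 := by
    intro R hR r hr
    rw [mem_PF] at hR
    have : (∑ s ∈ R, s) v = 0 := by rw [hR.2, hd']
    rw [Finset.sum_apply] at this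
    exact (Finset.sum_eq_zero_iff.1 this) r hr
  refine Finset.card_bij' (fun S _ => S \ T) (fun R _ => T ∪ R) ?_ ?_ ?_ ?_
  · intro S hS
    rw [Finset.mem_filter, mem_PF] at hS
    obtain ⟨⟨h1, h2⟩, h3⟩ := hS
    have hTS : T ⊆ S := by rw [← h3]; exact Finset.filter_subset _ _
    rw [mem_PF]
    refine ⟨fun s hs => h1 s (Finset.sdiff_subset hs), ?_⟩
    have := Finset.sum_sdiff (f := fun s : Fin k → ℕ => s) hTS
    rw [h2, add_comm] at this
    exact add_left_cancel this
  · intro R hR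
    have hk := key R hR
    rw [mem_PF] at hR
    have hdis : Disjoint T R := by
      rw [Finset.disjoint_left]
      intro t ht hr
      have := hv t ht
      have := hk t hr
      omega
    rw [Finset.mem_filter, mem_PF]
    refine ⟨⟨?_, ?_⟩, ?_⟩
    · intro s hs
      rcases Finset.mem_union.1 hs with h | h
      · exact hT s h
      · exact hR.1 s h
    · rw [Finset.sum_union hdis, hR.2]
    · ext s
      simp only [starAt, Finset.mem_filter, Finset.mem_union]
      constructor
      · rintro ⟨h | h, h'⟩
        · exact h
        · have := hk s h; omega
      · intro h
        exact ⟨Or.inl h, hv s h⟩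
  · intro S hS
    rw [Finset.mem_filter] at hS
    have hTS : T ⊆ S := by rw [← hS.2]; exact Finset.filter_subset _ _
    exact Finset.union_sdiff_of_subset hTS
  · intro R hR
    have hk := key R hR
    have hdis : Disjoint T R := by
      rw [Finset.disjoint_left]
      intro t ht hr
      have := hv t ht
      have := hk t hr
      omega
    exact Finset.union_sdiff_cancel_left hdis

/-- indicator vector -/
noncomputable def ind (A : Finset (Fin k)) : Fin k → ℕ := fun i => if i ∈ A then 1 else 0

lemma ind_eq_single_add {A : Finset (Fin k)} {x : Fin k} (hx : x ∈ A) :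
    ind A = Pi.single x 1 + ind (A.erase x) := by
  funext i
  by_cases hi : i = x
  · subst hi; simp [ind, hx]
  · simp [ind, hi]

lemma starAt_sum (v : Fin k) (S : Finset (Fin k → ℕ)) :
    ∑ t ∈ starAt v S, t v = (∑ s ∈ S, s) v := by
  rw [Finset.sum_apply]
  unfold starAt
  apply Finset.sum_filter_of_ne
  intro x _ h
  omega

lemma PF_zero : PF (0 : Fin k → ℕ) = {∅} := by
  ext S
  rw [mem_PF, Finset.mem_singleton]
  constructor
  · rintro ⟨h1, h2⟩
    have := deg_sum S h1
    rw [h2] at this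
    have h0 : degFn (0 : Fin k → ℕ) = 0 := (deg_zero_iff _).2 rfl
    rw [h0] at this
    exact Finset.card_eq_zero.1 (by omega)
  · rintro rfl
    simp

lemma card_matching (m : ℕ) : ∀ A : Finset (Fin k), A.card = 2 * m →
    (PF (ind A)).card = Nat.doubleFactorial (2 * m - 1) := by
  induction m with
  | zero =>
    intro A hA
    have : A = ∅ := Finset.card_eq_zero.1 (by simpa using hA)
    subst this
    have : ind (∅ : Finset (Fin k)) = 0 := by funext i; simp [ind]
    rw [this, PF_zero]; rfl
  | succ m ih =>
    intro A hA
    obtain ⟨x, hx⟩ : A.Nonempty := Finset.card_pos.1 (by omega)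
    set g : Fin k → Finset (Fin k → ℕ) := fun y => {Pi.single x 1 + Pi.single y 1} with hg
    have hginj : Function.Injective g := by
      intro y z h
      simp only [hg, Finset.singleton_inj] at h
      have := add_left_cancel h
      by_contra hne
      have := congrFun this y
      simp [hne] at this
    rw [Finset.card_eq_sum_card_fiberwise (f := starAt x) (t := (A.erase x).image g)]
    · rw [Finset.sum_image (fun a _ b _ h => hginj h)]
      have : ∀ y ∈ A.erase x, ((PF (ind A)).filter fun S => starAt x S = g y).card
          = Nat.doubleFactorial (2 * m - 1) := by
        intro y hy
        rw [card_fiber x (g y) (ind A) (ind ((A.erase x).erase y))]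
        · apply ih
          rw [Finset.card_erase_of_mem hy, Finset.card_erase_of_mem hx]; omega
        · simp [hg, deg_add, deg_single]
        · simp [hg]
        · rw [ind_eq_single_add hx, ind_eq_single_add hy]
          simp [hg, add_assoc]
        · simp [ind]
      rw [Finset.sum_congr rfl this, Finset.sum_const, Finset.card_erase_of_mem hx, hA, smul_eq_mul]
      rcases m with _ | m
      · rfl
      · have : 2 * (m + 1 + 1) - 1 = (2 * (m + 1) - 1) + 2 := by omega
        rw [this, Nat.doubleFactorial_add_two]
    · intro S hS
      have hS := mem_PF.1 (Finset.mem_coe.1 hS)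
      have h1 := starAt_sum x S
      rw [hS.2] at h1
      simp only [ind, hx, if_true] at h1
      have hle : (starAt x S).card ≤ 1 := by
        rw [← h1, Finset.card_eq_sum_ones]
        apply Finset.sum_le_sum
        intro t ht
        exact (Finset.mem_filter.1 ht).2
      have hne : (starAt x S).card ≠ 0 := by
        intro h
        rw [Finset.card_eq_zero.1 h] at h1
        simp at h1
      obtain ⟨t, ht⟩ := Finset.card_eq_one.1 (show (starAt x S).card = 1 by omega)
      have htS : t ∈ starAt x S := by rw [ht]; simp
      have htS' := Finset.mem_filter.1 htS
      obtain ⟨y, rfl⟩ := deg_two (hS.1 t htS'.1) htS'.2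
      rw [ht] at h1
      have hle : (Pi.single x 1 + Pi.single y 1 : Fin k → ℕ) ≤ ind A := by
        rw [← hS.2]
        exact Finset.single_le_sum (f := fun s : Fin k → ℕ => s) (fun i _ => zero_le) htS'.1
      rw [Finset.mem_coe, Finset.mem_image]
      refine ⟨y, ?_, by rw [ht]⟩
      have hyx : y ≠ x := by
        rintro rfl
        simp at h1
      rw [Finset.mem_erase]
      refine ⟨hyx, ?_⟩
      by_contra hyA
      have := hle y
      simp [ind, hyA] at this

lemma card_center (m : ℕ) (hk : k = 2 * m + 1) (v : Fin k) :
    (PF (1 + Pi.single v 1 : Fin k → ℕ)).card =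
      Nat.doubleFactorial (2 * m - 1) + (2 * m).choose 2 * Nat.doubleFactorial (2 * m - 3) := by
  set E : Fin k → Fin k → ℕ := fun y => Pi.single v 1 + Pi.single y 1 with hE
  have hEinj : Function.Injective E := by
    intro y z h
    have := add_left_cancel h
    by_contra hne
    have := congrFun this y
    simp [hne] at this
  set g : Finset (Fin k) → Finset (Fin k → ℕ) := fun B => B.image E with hg
  have hginj : Function.Injective g := Finset.image_injective hEinj
  have h1 : (1 : Fin k → ℕ) = ind Finset.univ := by funext i; simp [ind]
  have hcard : (Finset.univ.erase v).card = 2 * m := by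
    rw [Finset.card_erase_of_mem (Finset.mem_univ _), Finset.card_univ, Fintype.card_fin]; omega
  have hdisj : Disjoint ({{v}} : Finset (Finset (Fin k)))
      ((Finset.univ.erase v).powersetCard 2) := by
    rw [Finset.disjoint_singleton_left, Finset.mem_powersetCard]
    simp
  rw [Finset.card_eq_sum_card_fiberwise (f := starAt v)
    (t := ({{v}} ∪ (Finset.univ.erase v).powersetCard 2).image g)]
  · rw [Finset.sum_image (fun a _ b _ h => hginj h), Finset.sum_union hdisj, Finset.sum_singleton]
    congr 1
    · rw [card_fiber v (g {v}) _ (ind (Finset.univ.erase v))]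
      · exact card_matching m _ hcard
      · simp [hg, hE, deg_add, deg_single]
      · simp [hg, hE]
      · rw [h1, ind_eq_single_add (Finset.mem_univ v)]
        simp only [hg, hE, Finset.image_singleton, Finset.sum_singleton]
        abel
      · simp [ind]
    · have : ∀ B ∈ (Finset.univ.erase v).powersetCard 2,
          ((PF (1 + Pi.single v 1 : Fin k → ℕ)).filter fun S => starAt v S = g B).card
          = Nat.doubleFactorial (2 * m - 3) := by
        intro B hB
        rw [Finset.mem_powersetCard] at hB
        obtain ⟨hB1, hB2⟩ := hB
        have hm : 1 ≤ m := by
          have := Finset.card_le_card hB1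
          omega
        obtain ⟨a, b, hab, rfl⟩ := Finset.card_eq_two.1 hB2
        have ha : a ∈ Finset.univ.erase v := hB1 (by simp)
        have hb : b ∈ (Finset.univ.erase v).erase a :=
          Finset.mem_erase.2 ⟨hab.symm, hB1 (by simp)⟩
        rw [card_fiber v (g {a, b}) _ (ind (((Finset.univ.erase v).erase a).erase b))]
        · rw [card_matching (m - 1)]
          · congr 1; omega
          · rw [Finset.card_erase_of_mem hb, Finset.card_erase_of_mem ha, hcard]; omega
        · simp [hg, hE, deg_add, deg_single]
        · simp [hg, hE]
        · rw [h1, ind_eq_single_add (Finset.mem_univ v), ind_eq_single_add ha,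
            ind_eq_single_add hb]
          simp only [hg]
          rw [Finset.sum_image (fun a _ b _ h => hEinj h), Finset.sum_pair hab]
          simp only [hE]
          abel
        · simp [ind]
      rw [Finset.sum_congr rfl this, Finset.sum_const, Finset.card_powersetCard, hcard, smul_eq_mul]
  · intro S hS
    have hS := mem_PF.1 (Finset.mem_coe.1 hS)
    have hs := starAt_sum v S
    rw [hS.2] at hs
    simp only [Pi.add_apply, Pi.one_apply, Pi.single_eq_same] at hs
    have hst : ∀ t ∈ starAt v S, ∃ y, E y = t := by
      intro t ht
      have ht' := Finset.mem_filter.1 ht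
      obtain ⟨y, hy⟩ := deg_two (hS.1 t ht'.1) ht'.2
      exact ⟨y, hy.symm⟩
    obtain ⟨B, hB⟩ : ∃ B : Finset (Fin k), g B = starAt v S := by
      refine ⟨Finset.univ.filter fun y => E y ∈ starAt v S, ?_⟩
      ext t
      simp only [hg, Finset.mem_image, Finset.mem_filter, Finset.mem_univ, true_and]
      constructor
      · rintro ⟨y, hy, rfl⟩; exact hy
      · intro ht
        obtain ⟨y, rfl⟩ := hst t ht
        exact ⟨y, ht, rfl⟩
    rw [Finset.mem_coe, Finset.mem_image]
    refine ⟨B, ?_, hB⟩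
    rw [← hB] at hs
    simp only [hg] at hs
    rw [Finset.sum_image (fun a _ b _ h => hEinj h)] at hs
    simp only [hE, Pi.add_apply, Pi.single_eq_same, Finset.sum_add_distrib, Finset.sum_const,
      smul_eq_mul, mul_one] at hs
    rw [Finset.mem_union, Finset.mem_singleton, Finset.mem_powersetCard]
    by_cases hvB : v ∈ B
    · left
      rw [← Finset.add_sum_erase _ _ hvB] at hs
      have hpos : 0 < B.card := Finset.card_pos.2 ⟨v, hvB⟩
      simp only [Pi.single_eq_same] at hs
      obtain ⟨w, rfl⟩ := Finset.card_eq_one.1 (show B.card = 1 by omega)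
      rw [Finset.mem_singleton.1 hvB]
    · right
      refine ⟨fun y hy => Finset.mem_erase.2 ⟨?_, Finset.mem_univ _⟩, ?_⟩
      · rintro rfl; exact hvB hy
      · rw [Finset.sum_eq_zero] at hs
        · omega
        · intro y hy
          have : v ≠ y := by rintro rfl; exact hvB hy
          simp [this]

noncomputable def singles (k : ℕ) : Finset (Fin k → ℕ) :=
  Finset.univ.image fun i => Pi.single i 1

lemma single_inj {i j : Fin k} (h : (Pi.single i 1 : Fin k → ℕ) = Pi.single j 1) : i = j := by
  by_contra hne
  have := congrFun h i
  simp [hne] at this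

lemma card_singles : (singles k).card = k := by
  unfold singles
  rw [Finset.card_image_of_injective _ fun _ _ h => single_inj h]
  simp

lemma mem_singles {y : Fin k → ℕ} : y ∈ singles k ↔ degFn y = 1 := by
  simp only [singles, Finset.mem_image, Finset.mem_univ, true_and]
  constructor
  · rintro ⟨i, rfl⟩; exact deg_single i
  · intro h
    obtain ⟨i, rfl⟩ := deg_one h
    exact ⟨i, rfl⟩

noncomputable def build (S : Finset (Fin k → ℕ)) : Finset (Fin k → ℕ) := ({0} ∪ singles k) ∪ S

lemma mem_build {S : Finset (Fin k → ℕ)} {y} :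
    y ∈ build S ↔ degFn y = 0 ∨ degFn y = 1 ∨ y ∈ S := by
  simp [build, mem_singles, deg_zero_iff]

lemma card_build {S : Finset (Fin k → ℕ)} (hS : ∀ s ∈ S, 2 ≤ degFn s) :
    (build S).card = 1 + k + S.card := by
  unfold build
  rw [Finset.card_union_of_disjoint, Finset.card_union_of_disjoint, card_singles]
  · simp
  · rw [Finset.disjoint_singleton_left, mem_singles, (deg_zero_iff _).2 rfl]; simp
  · rw [Finset.disjoint_right]
    intro s hs h
    have := hS s hs
    rw [Finset.mem_union, Finset.mem_singleton, mem_singles, ← deg_zero_iff] at h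
    omega

lemma deg_one_fn : degFn (1 : Fin k → ℕ) = k := by simp [degFn]

lemma set_eq (e : ℕ) (he : 1 ≤ e) (hk : k = 2 * e - 1) :
    {lam : Finset (Fin k → ℕ) | IsPartitionFn lam ∧ lam.card = 1 + k + e ∧
      hsFn lam 1 = k ∧ ∀ a ∈ socleFn lam, 2 ≤ degFn a} =
    (((Finset.univ : Finset (Fin k)).biUnion
      fun v => PF (1 + Pi.single v 1 : Fin k → ℕ)).image build : Finset _) := by
  ext lam
  simp only [Set.mem_setOf_eq, Finset.coe_image, Set.mem_image, Finset.mem_coe,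
    Finset.mem_biUnion, Finset.mem_univ, true_and]
  constructor
  · rintro ⟨hp, hc, h1, hsoc⟩
    set U := lam.filter fun a => 2 ≤ degFn a with hU
    set S := lam.filter fun a => degFn a = 2 with hSdef
    have hS2 : ∀ s ∈ S, degFn s = 2 := fun s hs => (Finset.mem_filter.1 hs).2
    have hfil : lam.filter (fun a => degFn a = 1) = singles k := by
      apply Finset.eq_of_subset_of_card_le
      · intro a ha
        exact mem_singles.2 (Finset.mem_filter.1 ha).2
      · rw [card_singles]; exact h1.ge
    have hsing : ∀ y : Fin k → ℕ, degFn y = 1 → y ∈ lam := by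
      intro y hy
      have := mem_singles.2 hy
      rw [← hfil] at this
      exact (Finset.mem_filter.1 this).1
    have h0 : (0 : Fin k → ℕ) ∈ lam := by
      obtain ⟨a, ha⟩ := Finset.card_pos.1 (show 0 < lam.card by omega)
      exact hp a ha 0 zero_le
    have hlam : lam = build U := by
      ext y
      rw [mem_build]
      constructor
      · intro hy
        by_cases h : 2 ≤ degFn y
        · exact Or.inr (Or.inr (Finset.mem_filter.2 ⟨hy, h⟩))
        · omega
      · rintro (h | h | h)
        · rw [(deg_zero_iff y).1 h]; exact h0
        · exact hsing y h
        · exact (Finset.mem_filter.1 h).1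
    have hUc : U.card = e := by
      have := card_build (S := U) (fun s hs => (Finset.mem_filter.1 hs).2)
      rw [← hlam] at this
      omega
    have hcov : (1 : Fin k → ℕ) ≤ ∑ s ∈ S, s := by
      intro i
      have hi : (Pi.single i 1 : Fin k → ℕ) ∈ lam := hsing _ (deg_single i)
      have hns : (Pi.single i 1 : Fin k → ℕ) ∉ socleFn lam := by
        intro h
        have := hsoc _ h
        rw [deg_single] at this
        omega
      simp only [socleFn, Finset.mem_filter, not_and, not_forall, not_not] at hns
      obtain ⟨b, hb, hlt⟩ := hns hi
      obtain ⟨z, rfl⟩ := exists_add_of_le hlt.le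
      obtain ⟨j, hj⟩ := exists_pos_of_ne (y := z) (by rintro rfl; simp at hlt)
      have hcS : (Pi.single i 1 + Pi.single j 1 : Fin k → ℕ) ∈ S := by
        rw [hSdef, Finset.mem_filter]
        refine ⟨hp _ hb _ (add_le_add le_rfl (single_le hj)), ?_⟩
        rw [deg_add, deg_single, deg_single]
      have := Finset.single_le_sum (f := fun s : Fin k → ℕ => s) (fun i _ => zero_le) hcS i
      refine le_trans ?_ this
      simp
    have hSU : S ⊆ U := by
      intro s hs
      rw [hSdef, Finset.mem_filter] at hs
      rw [hU, Finset.mem_filter]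
      exact ⟨hs.1, hs.2.ge⟩
    have hd := deg_sum S hS2
    have hle := deg_mono hcov
    rw [hd, deg_one_fn] at hle
    have hcl := Finset.card_le_card hSU
    have hSUe : S = U := Finset.eq_of_subset_of_card_le hSU (by omega)
    obtain ⟨z, hz⟩ := exists_add_of_le hcov
    rw [hz, deg_add, deg_one_fn, hSUe, hUc] at hd
    obtain ⟨v, rfl⟩ := deg_one (y := z) (by omega)
    refine ⟨U, ⟨v, ?_⟩, hlam.symm⟩
    rw [← hSUe, mem_PF]
    exact ⟨hS2, hz⟩
  · rintro ⟨S, ⟨v, hS⟩, rfl⟩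
    rw [mem_PF] at hS
    obtain ⟨hS2, hsum⟩ := hS
    have hd := deg_sum S hS2
    rw [hsum, deg_add, deg_one_fn, deg_single] at hd
    refine ⟨?_, ?_, ?_, ?_⟩
    · intro a ha y hy
      rw [mem_build] at ha ⊢
      have hdy := deg_mono hy
      by_cases h2 : degFn y ≤ 1
      · omega
      · rcases ha with h | h | h
        · omega
        · omega
        · have := hS2 a h
          rw [eq_of_le_of_deg hy (by omega)]
          exact Or.inr (Or.inr h)
    · rw [card_build (fun s hs => (hS2 s hs).ge)]; omega
    · unfold hsFn
      have : (build S).filter (fun a => degFn a = 1) = singles k := by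
        ext y
        rw [Finset.mem_filter, mem_build, mem_singles]
        constructor
        · exact fun h => h.2
        · exact fun h => ⟨Or.inr (Or.inl h), h⟩
      rw [this, card_singles]
    · intro a ha
      simp only [socleFn, Finset.mem_filter] at ha
      obtain ⟨hab, hmax⟩ := ha
      by_contra hlt
      have h01 : degFn a = 0 ∨ degFn a = 1 := by omega
      rcases h01 with h | h
      · rw [deg_zero_iff] at h
        subst h
        refine hmax (Pi.single v 1) (mem_build.2 (Or.inr (Or.inl (deg_single v)))) ?_
        refine lt_of_le_of_ne zero_le ?_
        intro h
        have := deg_single v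
        rw [← h, (deg_zero_iff _).2 rfl] at this
        omega
      · obtain ⟨i, rfl⟩ := deg_one h
        have : 0 < (∑ s ∈ S, s) i := by rw [hsum]; simp
        rw [Finset.sum_apply] at this
        obtain ⟨s, hs, hsi⟩ := Finset.exists_ne_zero_of_sum_ne_zero this.ne'
        refine hmax s (mem_build.2 (Or.inr (Or.inr hs))) ?_
        refine lt_of_le_of_ne (single_le (Nat.pos_of_ne_zero hsi)) ?_
        intro h'
        have := hS2 s hs
        rw [← h'] at this
        omega

end Aux

/-- Proposition `rem:limitcases`(5): for `e ≥ 1`, `c_e^{2e−1} = e·(2e−1)!!`. -/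
theorem stmt8 (e : ℕ) (he : 1 ≤ e) :
    cNum e (2 * e - 1) = e * Nat.doubleFactorial (2 * e - 1) := by
  unfold cNum
  rw [set_eq e he rfl, Set.ncard_coe_finset, Finset.card_image_of_injOn, Finset.card_biUnion]
  · obtain ⟨m, rfl⟩ : ∃ m, e = m + 1 := ⟨e - 1, by omega⟩
    rw [Finset.sum_congr rfl fun v _ => card_center m (by omega) v, Finset.sum_const,
      Finset.card_univ, Fintype.card_fin, smul_eq_mul]
    rcases m with _ | _ | m
    · rfl
    · rfl
    · have h1 : 2 * (m + 1 + 1 + 1) - 1 = (2 * m + 1) + 2 + 2 := by omega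
      have h2 : 2 * (m + 1 + 1) - 1 = (2 * m + 1) + 2 := by omega
      have h3 : 2 * (m + 1 + 1) - 3 = 2 * m + 1 := by omega
      have h4 : (2 * (m + 1 + 1)).choose 2 = (m + 2) * (2 * m + 3) := by
        rw [Nat.choose_two_right]
        apply Nat.div_eq_of_eq_mul_left (by norm_num)
        rw [h2]; ring
      rw [h1, h2, h3, h4, Nat.doubleFactorial_add_two (2 * m + 1 + 2),
        Nat.doubleFactorial_add_two (2 * m + 1)]
      ring
  · intro v _ w _ hvw
    refine Finset.disjoint_left.2 ?_
    intro S hS hS'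
    rw [mem_PF] at hS hS'
    exact hvw (single_inj (add_left_cancel (hS.2.symm.trans hS'.2)))
  · intro S hS T hT h
    have hS2 : ∀ S ∈ ((Finset.univ : Finset (Fin (2 * e - 1))).biUnion
        fun v => PF (1 + Pi.single v 1 : Fin (2 * e - 1) → ℕ)), ∀ s ∈ S, degFn s = 2 := by
      intro S hS
      rw [Finset.mem_biUnion] at hS
      obtain ⟨v, -, hv⟩ := hS
      exact (mem_PF.1 hv).1
    have hS := hS2 S hS
    have hT := hS2 T hT
    ext y
    have := Finset.ext_iff.1 h y
    rw [mem_build, mem_build] at this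
    constructor
    · intro hy
      have := hS y hy
      have : ¬ (degFn y = 0) ∧ ¬ (degFn y = 1) := by omega
      tauto
    · intro hy
      have := hT y hy
      have : ¬ (degFn y = 0) ∧ ¬ (degFn y = 1) := by omega
      tauto
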